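/- Let φ : X → ℝ be a normalized potential with summable variation and μ_φ its unique equilibrium state. Then there exists a sequence of strings (A_n)_{n≥1} with A_n ∈ A^n such that lim_n (1/n) log μ_φ(A_n) = γ^+(μ_φ) and lim_n τ(A_n)/n = 0. -/

import Mathlib

open MeasureTheory Filter Topology Set

namespace RTSpec

variable (A : Type*) [Fintype A] [TopologicalSpace A] [DiscreteTopology A]
  [MeasurableSpace A] [BorelSpace A]

/-- The sequence space `X = A^ℕ` (0-indexed: `x 0` is the paper's `x₁`). -/
abbrev X := ℕ → A

/-- The shift map `θ`. -/
def shift : X A → X A := fun x n => x (n + 1)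

/-- The cylinder `[a_1^n]` based on the word `w = a_1^n`. -/
def cyl {n : ℕ} (w : Fin n → A) : Set (X A) := {x | ∀ i : Fin n, x i.val = w i}

/-- Return time `R_n(x) = inf {k ≥ 2 : x_k^{k+n-1} = x_1^n}` (with `sInf ∅ = 0`). -/
noncomputable def retTime (n : ℕ) (x : X A) : ℕ := sInf {k | 2 ≤ k ∧ ∀ i < n, x (k - 1 + i) = x i}

/-- Hitting time `T_{a_1^n}(y) = inf {k ≥ 1 : y_k^{k+n-1} = a_1^n}`. -/
noncomputable def hitTime {n : ℕ} (w : Fin n → A) (y : X A) : ℕ :=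
  sInf {k | 1 ≤ k ∧ ∀ i : Fin n, y (k - 1 + i.val) = w i}

/-- Hitting/return time in the shifted sense: `inf {k ≥ 1 : θ^k y ∈ [a_1^n]}`. -/
noncomputable def hitTime' {n : ℕ} (w : Fin n → A) (y : X A) : ℕ :=
  sInf {k | 1 ≤ k ∧ ∀ i : Fin n, y (k + i.val) = w i}

/-- `τ(a_1^n) = inf {k ≥ 1 : [a_1^n] ∩ θ^{-k}[a_1^n] ≠ ∅}`, the smallest return time
of the cylinder `[a_1^n]`. -/
noncomputable def tau {n : ℕ} (w : Fin n → A) : ℕ :=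
  sInf {k | 1 ≤ k ∧ (cyl A w ∩ {y | ∀ i : Fin n, y (k + i.val) = w i}).Nonempty}

/-- `ζ_μ(a_1^n) = μ([a_1^n] ∩ {T_{a_1^n} ≠ τ(a_1^n)}) / μ([a_1^n])`. -/
noncomputable def zeta (μ : Measure (X A)) {n : ℕ} (w : Fin n → A) : ℝ :=
  (μ (cyl A w ∩ {y | hitTime' A w y ≠ tau A w})).toReal / (μ (cyl A w)).toReal

/-- A shift-invariant Borel probability measure. -/
def InvProb (η : Measure (X A)) : Prop :=
  IsProbabilityMeasure η ∧ Measure.map (shift A) η = η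

/-- The `n`-th term `-(1/n) Σ_{a_1^n} μ(a_1^n) log μ(a_1^n)` of the entropy sequence. -/
noncomputable def entSeq (μ : Measure (X A)) (n : ℕ) : ℝ :=
  -(1 / (n : ℝ)) * ∑ w : Fin n → A, (μ (cyl A w)).toReal * Real.log (μ (cyl A w)).toReal

/-- The entropy `h(μ)`, i.e. the limit of `entSeq` (which always exists for a
shift-invariant measure; we realize it as a liminf). -/
noncomputable def entropy (μ : Measure (X A)) : ℝ := atTop.liminf (entSeq A μ)

/-- Topological pressure `P(ψ) = sup_η {h(η) + ∫ ψ dη}`, the supremum running over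
all shift-invariant probability measures. -/
noncomputable def pressure (ψ : X A → ℝ) : ℝ :=
  sSup {r | ∃ η : Measure (X A), InvProb A η ∧ r = entropy A η + ∫ x, ψ x ∂η}

/-- `sup_η ∫ φ dη` over shift-invariant probability measures. -/
noncomputable def supInt (φ : X A → ℝ) : ℝ :=
  sSup {r | ∃ η : Measure (X A), InvProb A η ∧ r = ∫ x, φ x ∂η}

/-- `inf_η ∫ φ dη` over shift-invariant probability measures. -/
noncomputable def infInt (φ : X A → ℝ) : ℝ :=
  sInf {r | ∃ η : Measure (X A), InvProb A η ∧ r = ∫ x, φ x ∂η}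

/-- `var_n(φ) = sup {|φ(x) - φ(y)| : x_1^n = y_1^n}`. -/
noncomputable def Var (φ : X A → ℝ) (n : ℕ) : ℝ :=
  sSup {r | ∃ x y : X A, (∀ i < n, x i = y i) ∧ r = |φ x - φ y|}

/-- Prepending a symbol: `ax = (a, x_1, x_2, …)`. -/
def prepend (a : A) (x : X A) : X A := fun n => Nat.casesOn n a x

/-- A potential `φ` is normalized if `Σ_{a ∈ A} e^{φ(ax)} = 1` for all `x`. -/
def Normalized (φ : X A → ℝ) : Prop :=
  ∀ x : X A, ∑ a : A, Real.exp (φ (prepend A a x)) = 1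

/-- `μ` is an equilibrium state for `φ`: a probability measure fixed by the dual
transfer operator, i.e. `∫ L_φ f dμ = ∫ f dμ` for every continuous `f`. -/
def IsEqSt (φ : X A → ℝ) (μ : Measure (X A)) : Prop :=
  IsProbabilityMeasure μ ∧ ∀ f : X A → ℝ, Continuous f →
    ∫ x, (∑ a : A, Real.exp (φ (prepend A a x)) * f (prepend A a x)) ∂μ = ∫ x, f x ∂μ

/-- The `n`-th term `(1/n) log ∫ R_n^q dμ` of the return-time `L^q`-spectrum,
with values in `EReal` (the integral may be infinite). -/
noncomputable def RSeq (μ : Measure (X A)) (q : ℝ) (n : ℕ) : EReal :=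
  (((n : ℝ)⁻¹ : ℝ) : EReal) *
    ENNReal.log (∫⁻ x, ENNReal.ofReal ((retTime A n x : ℝ) ^ q) ∂μ)

/-- The `n`-th term `(1/n) log Σ_{a_1^n} μ(a_1^n)^{1-q}` of the `L^q`-spectrum of `μ`. -/
noncomputable def MSeq (μ : Measure (X A)) (q : ℝ) (n : ℕ) : ℝ :=
  (1 / (n : ℝ)) * Real.log (∑ w : Fin n → A, (μ (cyl A w)).toReal ^ (1 - q))

/-- `Λ^{(n)}(μ) = (1/n) log Σ_{a_1^n} (1 - ζ_μ(a_1^n)) μ(a_1^n)`. -/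
noncomputable def LamSeq (μ : Measure (X A)) (n : ℕ) : ℝ :=
  (1 / (n : ℝ)) * Real.log (∑ w : Fin n → A, (1 - zeta A μ w) * (μ (cyl A w)).toReal)

/-- `(1/n) log max_{a_1^n} μ(a_1^n)`. -/
noncomputable def gammaSeq (μ : Measure (X A)) (n : ℕ) : ℝ :=
  (1 / (n : ℝ)) * Real.log (⨆ w : Fin n → A, (μ (cyl A w)).toReal)

/-- `μ` is φ-mixing with rate `ϕ`: `ϕ` decreases to `0` and for all `n, ℓ ≥ 1`,
all `S` in the σ-algebra generated by coordinates `1, …, n` with `μ S ≠ 0`, and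
all `T` in the σ-algebra generated by coordinates `n+ℓ, n+ℓ+1, …`,
`|μ(S ∩ T)/μ(S) - μ(T)| ≤ ϕ(ℓ)`. -/
def PhiMixing (μ : Measure (X A)) (ϕ : ℕ → ℝ) : Prop :=
  (∀ ℓ, 0 < ϕ ℓ) ∧ Antitone ϕ ∧ Tendsto ϕ atTop (nhds 0) ∧
  ∀ n ℓ : ℕ, 1 ≤ n → 1 ≤ ℓ →
    ∀ S T : Set (X A),
      MeasurableSet[MeasurableSpace.comap
        (fun x : X A => fun i : Fin n => x i.val) inferInstance] S →
      MeasurableSet[MeasurableSpace.comap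
        (fun x : X A => fun j : ℕ => x (n + ℓ - 1 + j)) inferInstance] T →
      μ S ≠ 0 →
      |(μ (S ∩ T)).toReal / (μ S).toReal - (μ T).toReal| ≤ ϕ ℓ

/-- The points of `X` that agree with `w` in the first `n` coordinates. -/
def prefixSet (n : ℕ) (w : X A) : Set (X A) := {x | ∀ i < n, x i = w i}

/-- The concatenation of the first `n` letters of `w` with `x`. -/
def splice : ℕ → X A → X A → X A
  | 0, _, x => x
  | n + 1, w, x => prepend A (w 0) (splice n (shift A w) x)

/-- The Birkhoff sum of `φ` over the first `n` shifts of `splice A n w x`. -/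
noncomputable def spliceSum (φ : X A → ℝ) : ℕ → X A → X A → ℝ
  | 0, _, _ => 0
  | n + 1, w, x => φ (splice A (n + 1) w x) + spliceSum φ n (shift A w) x

variable {A}

omit [Fintype A] [DiscreteTopology A] [MeasurableSpace A] [BorelSpace A] in
lemma continuous_prepend (a : A) : Continuous (prepend A a) := by
  refine continuous_pi fun i => ?_
  cases i with
  | zero => exact continuous_const
  | succ i => exact continuous_apply i

omit [Fintype A] [DiscreteTopology A] [MeasurableSpace A] [BorelSpace A] in
lemma continuous_splice (n : ℕ) (w : X A) : Continuous (splice A n w) := by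
  induction n generalizing w with
  | zero => exact continuous_id
  | succ n ih => exact (continuous_prepend _).comp (ih _)

omit [Fintype A] [DiscreteTopology A] [MeasurableSpace A] [BorelSpace A] in
lemma continuous_spliceSum {φ : X A → ℝ} (hφ : Continuous φ) (n : ℕ) (w : X A) :
    Continuous (spliceSum A φ n w) := by
  induction n generalizing w with
  | zero => exact continuous_const
  | succ n ih => exact (hφ.comp (continuous_splice _ _)).add (ih _)

omit [Fintype A] [TopologicalSpace A] [DiscreteTopology A] [MeasurableSpace A] [BorelSpace A] in
lemma splice_of_lt {n : ℕ} (w x : X A) {i : ℕ} (hi : i < n) : splice A n w x i = w i := by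
  induction n generalizing w i with
  | zero => omega
  | succ n ih =>
    cases i with
    | zero => rfl
    | succ i => exact ih (shift A w) (by omega)

omit [Fintype A] [TopologicalSpace A] [DiscreteTopology A] [MeasurableSpace A] [BorelSpace A] in
lemma splice_add (n : ℕ) (w x : X A) (i : ℕ) : splice A n w x (n + i) = x i := by
  induction n generalizing w with
  | zero => simp [splice]
  | succ n ih => rw [Nat.add_right_comm]; exact ih (shift A w)

omit [Fintype A] [TopologicalSpace A] [DiscreteTopology A] [MeasurableSpace A] [BorelSpace A] in
lemma prepend_mem_prefixSet_succ {n : ℕ} {w x : X A} {a : A} :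
    prepend A a x ∈ prefixSet A (n + 1) w ↔ a = w 0 ∧ x ∈ prefixSet A n (shift A w) := by
  constructor
  · intro h
    exact ⟨h 0 (by omega), fun i hi => h (i + 1) (by omega)⟩
  · rintro ⟨h0, h⟩ i hi
    cases i with
    | zero => exact h0
    | succ i => exact h i (by omega)

omit [Fintype A] [TopologicalSpace A] [DiscreteTopology A] [MeasurableSpace A] [BorelSpace A] in
lemma splice_mem_prefixSet_add {n m : ℕ} {w x : X A} :
    splice A n w x ∈ prefixSet A (n + m) w ↔ x ∈ prefixSet A m (fun i => w (n + i)) := by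
  constructor
  · intro h i hi
    rw [← splice_add n w x i]
    exact h (n + i) (by omega)
  · intro h i hi
    rcases lt_or_ge i n with hn | hn
    · exact splice_of_lt w x hn
    · obtain ⟨j, rfl⟩ := Nat.exists_eq_add_of_le hn
      rw [splice_add]
      exact h j (by omega)

omit [Fintype A] [MeasurableSpace A] [BorelSpace A] in
lemma isClopen_prefixSet (n : ℕ) (w : X A) : IsClopen (prefixSet A n w) := by
  have h : prefixSet A n w = ⋂ i ∈ Finset.range n, (fun x : X A => x i) ⁻¹' {w i} := by
    ext x
    simp [prefixSet]
  rw [h]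
  exact isClopen_biInter_finset fun i _ => (isClopen_discrete _).preimage (continuous_apply i)

lemma measurableSet_prefixSet (n : ℕ) (w : X A) : MeasurableSet (prefixSet A n w) :=
  (isClopen_prefixSet n w).isOpen.measurableSet

omit [Fintype A] [MeasurableSpace A] [BorelSpace A] in
lemma continuous_indicator_prefixSet (n : ℕ) (w : X A) {F : X A → ℝ} (hF : Continuous F) :
    Continuous ((prefixSet A n w).indicator F) :=
  hF.indicator fun a ha => by simp [(isClopen_prefixSet n w).frontier_eq] at ha

lemma integrable_of_continuous {μ : Measure (X A)} [IsFiniteMeasure μ] {F : X A → ℝ}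
    (hF : Continuous F) : Integrable F μ :=
  hF.integrable_of_hasCompactSupport (HasCompactSupport.of_compactSpace F)

omit [TopologicalSpace A] [DiscreteTopology A] [MeasurableSpace A] [BorelSpace A] in
lemma sum_indicator_prepend (φ F : X A → ℝ) (n : ℕ) (w x : X A) :
    ∑ a : A, Real.exp (φ (prepend A a x)) *
        (prefixSet A (n + 1) w).indicator F (prepend A a x) =
      (prefixSet A n (shift A w)).indicator
        (fun y => Real.exp (φ (prepend A (w 0) y)) * F (prepend A (w 0) y)) x := by
  classical
  rw [Finset.sum_eq_single (w 0)]
  · simp [Set.indicator_apply, prepend_mem_prefixSet_succ]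
  · intro b _ hb
    simp [prepend_mem_prefixSet_succ, hb]
  · simp

omit [BorelSpace A] in
lemma integral_indicator_prefixSet {φ : X A → ℝ} (hφ : Continuous φ) {μ : Measure (X A)}
    (hμ : IsEqSt A φ μ) (n : ℕ) (w : X A) {F : X A → ℝ} (hF : Continuous F) :
    ∫ x, (prefixSet A n w).indicator F x ∂μ =
      ∫ x, Real.exp (spliceSum A φ n w x) * F (splice A n w x) ∂μ := by
  induction n generalizing w F with
  | zero => simp [prefixSet, spliceSum, splice]
  | succ n ih =>
    have hp := continuous_prepend (w 0)
    rw [← hμ.2 _ (continuous_indicator_prefixSet (n + 1) w hF)]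
    simp_rw [sum_indicator_prepend]
    have hF' : Continuous fun y => Real.exp (φ (prepend A (w 0) y)) * F (prepend A (w 0) y) :=
      (Real.continuous_exp.comp (hφ.comp hp)).mul (hF.comp hp)
    rw [ih (shift A w) hF']
    congr 1 with x
    simp only [spliceSum, splice, Real.exp_add]
    ring

lemma measureReal_prefixSet_add {φ : X A → ℝ} (hφ : Continuous φ) {μ : Measure (X A)}
    (hμ : IsEqSt A φ μ) (n m : ℕ) (w : X A) :
    μ.real (prefixSet A (n + m) w) =
      ∫ x, (prefixSet A m (fun i => w (n + i))).indicator
        (fun x => Real.exp (spliceSum A φ n w x)) x ∂μ := by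
  have hsub : prefixSet A n w ∩ prefixSet A (n + m) w = prefixSet A (n + m) w :=
    inter_eq_right.2 fun x hx i hi => hx i (by omega)
  have h := integral_indicator_prefixSet hφ hμ n w
    (continuous_indicator_prefixSet (n + m) w (continuous_const (y := (1 : ℝ))))
  rw [indicator_indicator, hsub,
    integral_indicator_const _ (measurableSet_prefixSet _ _), smul_eq_mul, mul_one] at h
  rw [h]
  congr 1 with x
  classical
  simp [Set.indicator_apply, splice_mem_prefixSet_add]

omit [DiscreteTopology A] [MeasurableSpace A] [BorelSpace A] in
lemma abs_sub_le_Var {φ : X A → ℝ} (hφ : Continuous φ) {n : ℕ} {x y : X A}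
    (h : ∀ i < n, x i = y i) : |φ x - φ y| ≤ Var A φ n := by
  refine le_csSup ?_ ⟨x, y, h, rfl⟩
  obtain ⟨K, hK⟩ := isCompact_univ.exists_bound_of_continuousOn hφ.continuousOn
  refine ⟨K + K, ?_⟩
  rintro _ ⟨x, y, -, rfl⟩
  exact (abs_sub _ _).trans (add_le_add (hK x trivial) (hK y trivial))

omit [DiscreteTopology A] [MeasurableSpace A] [BorelSpace A] in
lemma spliceSum_le_add_sum_Var {φ : X A → ℝ} (hφ : Continuous φ) (n : ℕ) (w x y : X A) :
    spliceSum A φ n w y ≤ spliceSum A φ n w x + ∑ j ∈ Finset.range n, Var A φ (j + 1) := by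
  induction n generalizing w with
  | zero => simp [spliceSum]
  | succ n ih =>
    have h := abs_sub_le_Var hφ (x := splice A (n + 1) w y) (y := splice A (n + 1) w x)
      (fun i hi => (splice_of_lt w y hi).trans (splice_of_lt w x hi).symm)
    rw [Finset.sum_range_succ]
    simp only [spliceSum]
    linarith [ih (shift A w), le_abs_self (φ (splice A (n + 1) w y) - φ (splice A (n + 1) w x))]

omit [Fintype A] [TopologicalSpace A] [DiscreteTopology A] [MeasurableSpace A] [BorelSpace A] in
lemma Var_nonneg {φ : X A → ℝ} (n : ℕ) : 0 ≤ Var A φ n :=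
  Real.sSup_nonneg (by rintro _ ⟨x, y, -, rfl⟩; exact abs_nonneg _)

/-- The lower quasi-Bernoulli inequality. -/
lemma mul_le_measureReal_prefixSet_add {φ : X A → ℝ} (hφ : Continuous φ)
    (hvar : Summable fun n => Var A φ (n + 1)) {μ : Measure (X A)} (hμ : IsEqSt A φ μ)
    (n m : ℕ) (w : X A) :
    Real.exp (-∑' j, Var A φ (j + 1)) * μ.real (prefixSet A n w) *
        μ.real (prefixSet A m fun i => w (n + i)) ≤ μ.real (prefixSet A (n + m) w) := by
  have := hμ.1
  have hcont := Real.continuous_exp.comp (continuous_spliceSum hφ n w)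
  obtain ⟨y, hy⟩ := exists_integral_le (μ := μ) (integrable_of_continuous hcont)
  have hn : μ.real (prefixSet A n w) ≤ Real.exp (spliceSum A φ n w y) := by
    have h := measureReal_prefixSet_add hφ hμ n 0 w
    have huniv : prefixSet A 0 (fun i => w (n + i)) = univ := by simp [prefixSet]
    rw [huniv, indicator_univ, add_zero] at h
    exact h.trans_le hy
  rw [measureReal_prefixSet_add hφ hμ n m w, mul_comm,
    ← smul_eq_mul, ← integral_indicator_const _ (measurableSet_prefixSet _ _)]
  refine integral_mono
    (integrable_of_continuous (continuous_indicator_prefixSet _ _ continuous_const))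
    (integrable_of_continuous (continuous_indicator_prefixSet _ _ hcont)) fun x => ?_
  refine indicator_le_indicator ?_
  calc Real.exp (-∑' j, Var A φ (j + 1)) * μ.real (prefixSet A n w)
      ≤ Real.exp (-∑' j, Var A φ (j + 1)) * Real.exp (spliceSum A φ n w y) := by gcongr
    _ = Real.exp (-∑' j, Var A φ (j + 1) + spliceSum A φ n w y) := (Real.exp_add _ _).symm
    _ ≤ Real.exp (spliceSum A φ n w x) := by
      gcongr
      linarith [spliceSum_le_add_sum_Var hφ n w x y,
        hvar.sum_le_tsum (Finset.range n) fun j _ => Var_nonneg (j + 1)]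

lemma pow_le_measureReal_prefixSet_mul {φ : X A → ℝ} (hφ : Continuous φ)
    (hvar : Summable fun n => Var A φ (n + 1)) {μ : Measure (X A)} (hμ : IsEqSt A φ μ)
    {k : ℕ} {w : X A} (hw : ∀ i, w (k + i) = w i) (m : ℕ) :
    (Real.exp (-∑' j, Var A φ (j + 1)) * μ.real (prefixSet A k w)) ^ m ≤
      μ.real (prefixSet A (m * k) w) := by
  have := hμ.1
  induction m with
  | zero => simp [prefixSet]
  | succ m ih =>
    have h := mul_le_measureReal_prefixSet_add hφ hvar hμ k (m * k) w
    simp_rw [hw] at h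
    rw [pow_succ', show (m + 1) * k = k + m * k by ring]
    exact (mul_le_mul_of_nonneg_left ih (by positivity)).trans h

omit [Fintype A] [TopologicalSpace A] [DiscreteTopology A] [MeasurableSpace A] [BorelSpace A] in
lemma cyl_restrict (n : ℕ) (w : X A) :
    cyl A (fun i : Fin n => w i) = prefixSet A n w := by
  ext x
  exact ⟨fun h i hi => h ⟨i, hi⟩, fun h i => h i i.2⟩

omit [Fintype A] [TopologicalSpace A] [DiscreteTopology A] [MeasurableSpace A] [BorelSpace A] in
lemma tau_le_of_periodic {k : ℕ} (hk : 1 ≤ k) {w : X A} (hw : ∀ i, w (k + i) = w i) (n : ℕ) :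
    tau A (fun i : Fin n => w i) ≤ k :=
  Nat.sInf_le ⟨hk, w, fun _ => rfl, fun i => hw i⟩

omit [DiscreteTopology A] [TopologicalSpace A] [BorelSpace A] in
lemma measureReal_cyl_le_iSup (μ : Measure (X A)) {n : ℕ} (w : Fin n → A) :
    (μ (cyl A w)).toReal ≤ ⨆ v : Fin n → A, (μ (cyl A v)).toReal :=
  le_ciSup (f := fun v : Fin n → A => (μ (cyl A v)).toReal) (Set.finite_range _).bddAbove w

omit [DiscreteTopology A] [TopologicalSpace A] [BorelSpace A] in
lemma iSup_measureReal_cyl_pos (μ : Measure (X A)) [IsProbabilityMeasure μ] (n : ℕ) :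
    0 < ⨆ v : Fin n → A, (μ (cyl A v)).toReal := by
  by_contra! h
  have hzero (v : Fin n → A) : μ (cyl A v) = 0 := by
    have h0 := le_antisymm ((measureReal_cyl_le_iSup μ v).trans h) ENNReal.toReal_nonneg
    exact (ENNReal.toReal_eq_zero_iff _).1 h0 |>.resolve_right (measure_ne_top _ _)
  have huniv : ⋃ v : Fin n → A, cyl A v = univ :=
    eq_univ_of_forall fun x => mem_iUnion.2 ⟨fun i => x i, fun _ => rfl⟩
  have h1 := measure_iUnion_null hzero
  rw [huniv, measure_univ] at h1
  exact one_ne_zero h1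

/-- Repeating a most likely word of length `k` gives words of every length with small period and
almost maximal measure. -/
lemma exists_word_tau_le [Nonempty A] {φ : X A → ℝ} (hφ : Continuous φ)
    (hvar : Summable fun n => Var A φ (n + 1)) {μ : Measure (X A)} (hμ : IsEqSt A φ μ)
    {k : ℕ} (hk : 1 ≤ k) (n : ℕ) :
    ∃ w : Fin n → A, tau A w ≤ k ∧ 0 < (μ (cyl A w)).toReal ∧
      ((n / k + 1 : ℕ) : ℝ) * (k * gammaSeq A μ k - ∑' j, Var A φ (j + 1)) ≤
        Real.log (μ (cyl A w)).toReal := by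
  have := hμ.1
  obtain ⟨v, hv⟩ := exists_eq_ciSup_of_finite (f := fun v : Fin k → A => (μ (cyl A v)).toReal)
  have hpos := iSup_measureReal_cyl_pos μ k
  set w : X A := fun i => v ⟨i % k, Nat.mod_lt _ hk⟩ with hw_def
  have hw (i : ℕ) : w (k + i) = w i := by simp [hw_def]
  have hwv : (fun i : Fin k => w i) = v := by
    ext i
    simp [hw_def, Nat.mod_eq_of_lt i.2]
  have hk0 : (k : ℝ) ≠ 0 := by positivity
  have hγ : k * gammaSeq A μ k = Real.log (μ.real (prefixSet A k w)) := by
    rw [gammaSeq, ← hv, ← cyl_restrict, hwv, ← mul_assoc, mul_one_div_cancel hk0, one_mul]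
    rfl
  have hposw : 0 < μ.real (prefixSet A k w) := by
    rw [← cyl_restrict, hwv]
    exact hpos.trans_eq hv.symm
  have hle : (Real.exp (-∑' j, Var A φ (j + 1)) * μ.real (prefixSet A k w)) ^ (n / k + 1) ≤
      μ.real (prefixSet A n w) :=
    (pow_le_measureReal_prefixSet_mul hφ hvar hμ hw _).trans <| measureReal_mono
      fun x hx i hi => hx i (hi.trans (by rw [mul_comm]; exact Nat.lt_mul_div_succ n hk))
  refine ⟨fun i => w i, tau_le_of_periodic hk hw n, ?_, ?_⟩
  · rw [cyl_restrict]
    exact lt_of_lt_of_le (by positivity) hle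
  · rw [cyl_restrict]
    refine le_trans (le_of_eq ?_) (Real.log_le_log (by positivity) hle)
    rw [Real.log_pow, Real.log_mul (Real.exp_ne_zero _) hposw.ne', Real.log_exp, hγ]
    ring

lemma tendsto_natSqrt_atTop : Tendsto Nat.sqrt atTop atTop :=
  tendsto_atTop.2 fun b => (eventually_ge_atTop (b * b)).mono fun _ h => Nat.le_sqrt.2 h

lemma tendsto_natSqrt_add_one_div :
    Tendsto (fun n : ℕ => ((Nat.sqrt n + 1 : ℕ) : ℝ) / n) atTop (𝓝 0) := by
  have h : Tendsto (fun n : ℕ => 2 / (Nat.sqrt n : ℝ)) atTop (𝓝 0) :=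
    tendsto_const_nhds.div_atTop (tendsto_natCast_atTop_atTop.comp tendsto_natSqrt_atTop)
  refine squeeze_zero' (Eventually.of_forall fun n => by positivity) ?_ h
  filter_upwards [eventually_ge_atTop 1] with n hn
  have hs : 1 ≤ Nat.sqrt n := Nat.le_sqrt.2 (by simpa using hn)
  have hs' : (1 : ℝ) ≤ Nat.sqrt n := by exact_mod_cast hs
  have hsq : (Nat.sqrt n : ℝ) * Nat.sqrt n ≤ n := by exact_mod_cast Nat.sqrt_le n
  rw [div_le_div_iff₀ (by positivity) (by positivity)]
  push_cast
  nlinarith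

lemma tendsto_div_succ_mul_div {k : ℕ → ℕ} (hk : ∀ n, 1 ≤ k n)
    (h : Tendsto (fun n => (k n : ℝ) / n) atTop (𝓝 0)) :
    Tendsto (fun n : ℕ => ((n / k n + 1 : ℕ) : ℝ) * k n / n) atTop (𝓝 1) := by
  have h1 : Tendsto (fun n => 1 + (k n : ℝ) / n) atTop (𝓝 1) := by
    simpa using h.const_add 1
  refine tendsto_of_tendsto_of_tendsto_of_le_of_le' tendsto_const_nhds h1 ?_ ?_ <;>
    filter_upwards [eventually_ge_atTop 1] with n hn <;>
    have hn0 : (0 : ℝ) < n := by exact_mod_cast hn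
  · rw [le_div_iff₀ hn0, one_mul]
    have := (Nat.lt_mul_div_succ n (hk n)).le
    rw [mul_comm] at this
    exact_mod_cast this
  · rw [div_le_iff₀ hn0, add_mul, one_mul, div_mul_cancel₀ _ hn0.ne']
    have := Nat.div_mul_le_self n (k n)
    have h2 : (n / k n + 1) * k n ≤ n + k n := by rw [add_mul, one_mul]; omega
    exact_mod_cast h2

variable (A)

/-- there is a sequence of words `A_n ∈ A^n` with
`(1/n) log μ_φ(A_n) → γ⁺(μ_φ)` and `τ(A_n)/n → 0`. -/
theorem good_words_with_sublinear_period
    (hcard : 1 < Fintype.card A)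
    (φ : X A → ℝ) (hφc : Continuous φ)
    (hvar : Summable (fun n => Var A φ (n + 1)))
    (hnorm : Normalized A φ)
    (μφ : Measure (X A)) (hμ : IsEqSt A φ μφ)
    (γ : ℝ) (hγ : Tendsto (gammaSeq A μφ) atTop (nhds γ)) :
    ∃ W : (n : ℕ) → Fin n → A,
      Tendsto (fun n : ℕ => (1 / (n : ℝ)) * Real.log ((μφ (cyl A (W n))).toReal))
        atTop (nhds γ) ∧
      Tendsto (fun n : ℕ => (tau A (W n) : ℝ) / (n : ℝ)) atTop (nhds 0) := by
  have := hμ.1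
  have : Nonempty A := Fintype.card_pos_iff.1 (by omega)
  have hk (n : ℕ) : 1 ≤ Nat.sqrt n + 1 := by omega
  choose W hτ hpos hlow using fun n => exists_word_tau_le hφc hvar hμ (hk n) n
  have hkn := tendsto_natSqrt_add_one_div
  have hktop : Tendsto (fun n => Nat.sqrt n + 1) atTop atTop :=
    (tendsto_add_atTop_nat 1).comp tendsto_natSqrt_atTop
  refine ⟨W, ?_, ?_⟩
  · have hlim : Tendsto (fun n : ℕ =>
        ((n / (Nat.sqrt n + 1) + 1 : ℕ) : ℝ) * ((Nat.sqrt n + 1 : ℕ) : ℝ) / n *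
          (gammaSeq A μφ (Nat.sqrt n + 1) -
            (∑' j, Var A φ (j + 1)) / ((Nat.sqrt n + 1 : ℕ) : ℝ))) atTop (𝓝 γ) := by
      simpa using (tendsto_div_succ_mul_div hk hkn).mul ((hγ.comp hktop).sub
        ((tendsto_const_nhds (x := ∑' j, Var A φ (j + 1))).div_atTop
          (tendsto_natCast_atTop_atTop.comp hktop)))
    refine tendsto_of_tendsto_of_tendsto_of_le_of_le hlim hγ (fun n => ?_) fun n => ?_
    · have hk0 : ((Nat.sqrt n + 1 : ℕ) : ℝ) ≠ 0 := by positivity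
      refine le_trans (le_of_eq ?_)
        (mul_le_mul_of_nonneg_left (hlow n) (by positivity : (0 : ℝ) ≤ 1 / n))
      field_simp
    · exact mul_le_mul_of_nonneg_left
        (Real.log_le_log (hpos n) (measureReal_cyl_le_iSup μφ (W n))) (by positivity)
  · refine squeeze_zero (fun n => by positivity) (fun n => ?_) hkn
    gcongr
    exact hτ n

end RTSpec
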